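/- Let h = -d²/dx² + v on L²(ℝ) with v ∈ C(ℝ), v ≤ 0, v not identically 0, and v(x) → 0 as |x| → ∞. Then h has at least one negative eigenvalue; equivalently, there exists w ∈ C₀^∞(ℝ) with ∫_ℝ (|w'|² + v|w|²) dx < 0. -/

import Mathlib

open MeasureTheory Filter

/-- In dimension one, the Dirichlet energy of a dilate `x ↦ f (t * (x - a))` scales like `t`. -/
theorem integral_sq_deriv_comp_mul_sub {f : ℝ → ℝ} (hf : Differentiable ℝ f) (a : ℝ) {t : ℝ}
    (ht : 0 < t) :
    ∫ x, deriv (fun y => f (t * (y - a))) x ^ 2 = t * ∫ x, deriv f x ^ 2 := by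
  have hd : ∀ x, deriv (fun y => f (t * (y - a))) x = t * deriv f (t * (x - a)) := fun x => by
    have h : HasDerivAt (fun y : ℝ => t * (y - a)) t x := by
      simpa using ((hasDerivAt_id x).sub_const a).const_mul t
    rw [mul_comm]
    exact ((hf _).hasDerivAt.comp x h).deriv
  simp_rw [hd, mul_pow]
  rw [integral_const_mul, integral_sub_right_eq_self (fun x => deriv f (t * x) ^ 2) a,
    Measure.integral_comp_mul_left (fun x => deriv f x ^ 2) t, abs_of_pos (inv_pos.2 ht),
    smul_eq_mul]
  field_simp

/-- For `h = -d²/dx² + v` on `L²(ℝ)` with `v` continuous, nonpositive, not identically `0`,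
and vanishing at infinity, there is a compactly supported smooth test function `w` making
the quadratic form negative: `∫ (|w'|² + v|w|²) < 0`.  (Hence `h` has a negative
eigenvalue.) -/
theorem negative_bound_state_1d (v : ℝ → ℝ) (hv : Continuous v) (hle : ∀ x, v x ≤ 0)
    (hne : ∃ x, v x ≠ 0) (hdecay : Tendsto v (cocompact ℝ) (nhds 0)) :
    ∃ w : ℝ → ℝ, ContDiff ℝ (⊤ : ℕ∞) w ∧ HasCompactSupport w ∧
      ∫ x : ℝ, ((deriv w x) ^ 2 + v x * (w x) ^ 2) < 0 := by
  obtain ⟨a, ha⟩ := hne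
  let f : ContDiffBump (0 : ℝ) := ⟨1, 2, one_pos, one_lt_two⟩
  let w : ℝ → ℝ → ℝ := fun t x => f (t * (x - a))
  have hsmooth : ∀ t, ContDiff ℝ (⊤ : ℕ∞) (w t) := fun t =>
    f.contDiff.comp (contDiff_const.mul (contDiff_id.sub contDiff_const))
  have hsupp : ∀ t, 0 < t → HasCompactSupport (w t) := fun t ht =>
    f.hasCompactSupport.comp_homeomorph
      ((Homeomorph.subRight a).trans (Homeomorph.mulLeft₀ t ht.ne'))
  have hsupp_v : ∀ t, 0 < t → HasCompactSupport (fun x => v x * w t x ^ 2) := fun t ht =>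
    ((hsupp t ht).comp_left (g := fun y : ℝ => y ^ 2) (by simp)).mul_left
  have hcont_v : ∀ t, Continuous (fun x => v x * w t x ^ 2) := fun t =>
    hv.mul ((hsmooth t).continuous.pow 2)
  have hint_v : ∀ t, 0 < t → Integrable (fun x => v x * w t x ^ 2) := fun t ht =>
    (hcont_v t).integrable_of_hasCompactSupport (hsupp_v t ht)
  have hint_deriv : ∀ t, 0 < t → Integrable (fun x => deriv (w t) x ^ 2) := fun t ht =>
    Continuous.integrable_of_hasCompactSupport (f := fun x => deriv (w t) x ^ 2)
      (((hsmooth t).continuous_deriv (by simp)).pow 2)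
      ((hsupp t ht).deriv.comp_left (g := fun y : ℝ => y ^ 2) (by simp))
  set C := ∫ x, deriv f x ^ 2
  have hC : 0 ≤ C := integral_nonneg fun x => sq_nonneg _
  have hneg : ∫ x, v x * w 1 x ^ 2 < 0 := by
    have hpos : 0 < ∫ x, -(v x * w 1 x ^ 2) := by
      have hcont : Continuous fun x => -(v x * w 1 x ^ 2) := (hcont_v 1).neg
      have hcomp : HasCompactSupport fun x => -(v x * w 1 x ^ 2) :=
        (hsupp_v 1 one_pos).comp_left (g := fun y : ℝ => -y) neg_zero
      have hnonneg : ∀ x, 0 ≤ -(v x * w 1 x ^ 2) := fun x =>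
        neg_nonneg.2 (mul_nonpos_of_nonpos_of_nonneg (hle x) (sq_nonneg _))
      have hwa : w 1 a = 1 := f.one_of_mem_closedBall (by simp [f])
      exact hcont.integral_pos_of_hasCompactSupport_nonneg_nonzero hcomp hnonneg (x := a)
        (by simpa [hwa] using ha)
    rw [integral_neg] at hpos
    linarith
  have hmono : ∀ t, 0 < t → t ≤ 1 / 2 → ∫ x, v x * w t x ^ 2 ≤ ∫ x, v x * w 1 x ^ 2 := by
    intro t ht ht2
    refine integral_mono (hint_v t ht) (hint_v 1 one_pos) fun x => ?_
    suffices h : w 1 x ≤ w t x from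
      mul_le_mul_of_nonpos_left (pow_le_pow_left₀ f.nonneg h 2) (hle x)
    by_cases hx : |x - a| < 2
    · have : w t x = 1 := f.one_of_mem_closedBall <| by
        rw [mem_closedBall_zero_iff, Real.norm_eq_abs, abs_mul, abs_of_pos ht]
        change t * |x - a| ≤ 1
        nlinarith [abs_nonneg (x - a)]
      rw [this]
      exact f.le_one
    · have : w 1 x = 0 := f.zero_of_le_dist (by simpa [f, Real.dist_eq] using hx)
      rw [this]
      exact f.nonneg
  obtain ⟨t, ht, ht2, htC⟩ : ∃ t : ℝ, 0 < t ∧ t ≤ 1 / 2 ∧ t * C < -∫ x, v x * w 1 x ^ 2 := by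
    set c := -∫ x, v x * w 1 x ^ 2
    have hc : 0 < c := neg_pos.2 hneg
    refine ⟨min (1 / 2) (c / (C + 1)), by positivity, min_le_left _ _, ?_⟩
    calc min (1 / 2) (c / (C + 1)) * C ≤ c / (C + 1) * C := by gcongr; exact min_le_right _ _
      _ < c := by rw [div_mul_eq_mul_div, div_lt_iff₀ (by positivity)]; linarith
  refine ⟨w t, hsmooth t, hsupp t ht, ?_⟩
  rw [integral_add (hint_deriv t ht) (hint_v t ht),
    integral_sq_deriv_comp_mul_sub ((f.contDiff (n := 1)).differentiable one_ne_zero) a ht]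
  linarith [hmono t ht ht2]
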